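/- Let α ≥ 1/2 and let f : (0,1) → [0,∞) satisfy f(γ)/(log(1/(1−γ)))^{1/α} → 0 as γ → 1⁻. Then for every θ₀ ∈ ℝ, as γ → 1⁻, sup_{θ ∈ [θ₀−f(γ), θ₀+f(γ)]} |g_θ(S*(θ,γ))/(α·(log(1/(1−γ)))^{1−1/α}) − 1| → 0 and sup_{θ ∈ [θ₀−f(γ), θ₀+f(γ)]} |S*(θ,γ)·g_θ(S*(θ,γ))/(α·log(1/(1−γ))) − 1| → 0. -/

import Mathlib

open MeasureTheory Filter Set Topology

/-- Normalization constant `C₀ = (∫ exp(-|x|^α) dx)⁻¹`. -/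
noncomputable def C0 (α : ℝ) : ℝ := (∫ x : ℝ, Real.exp (-(|x| ^ α)))⁻¹

/-- Density `f_θ(x) = C₀ exp(-|x-θ|^α)`. -/
noncomputable def fd (α θ x : ℝ) : ℝ := C0 α * Real.exp (-(|x - θ| ^ α))

/-- Tail probability `P_θ(S) = ∫_S^∞ f_θ(x) dx`. -/
noncomputable def Ptail (α θ S : ℝ) : ℝ := ∫ x in Set.Ioi S, fd α θ x

/-- Conditional mean above `S`: `μ_θ(S) = (∫_S^∞ x f_θ(x) dx) / P_θ(S)`. -/
noncomputable def muTail (α θ S : ℝ) : ℝ := (∫ x in Set.Ioi S, x * fd α θ x) / Ptail α θ S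

/-- `g_θ(S) = P_θ(S) / ∫_S^∞ P_θ(x) dx`. -/
noncomputable def gfun (α θ S : ℝ) : ℝ := Ptail α θ S / ∫ x in Set.Ioi S, Ptail α θ x

/-- Hazard rate `h_θ(S) = f_θ(S)/P_θ(S)`. -/
noncomputable def hazard (α θ S : ℝ) : ℝ := fd α θ S / Ptail α θ S

theorem tendsto_rpow_mul_exp_neg_rpow_atTop {α : ℝ} (hα : 0 < α) (β : ℝ) :
    Tendsto (fun y : ℝ => y ^ β * Real.exp (-(y ^ α))) atTop (𝓝 0) := by
  have h := (tendsto_rpow_mul_exp_neg_mul_atTop_nhds_zero (β / α) 1 one_pos).comp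
    (tendsto_rpow_atTop hα)
  refine h.congr' ?_
  filter_upwards [eventually_gt_atTop 0] with y hy
  simp only [Function.comp_apply, neg_mul, one_mul]
  rw [← Real.rpow_mul hy.le, mul_div_cancel₀ β hα.ne']

theorem integrableOn_Ioi_of_tendsto_div {α β c : ℝ} (hα : 0 < α) {Q : ℝ → ℝ}
    (hQ : Continuous Q)
    (h : Tendsto (fun y => Q y / (y ^ β * Real.exp (-(y ^ α)))) atTop (𝓝 c)) (a : ℝ) :
    IntegrableOn Q (Ioi a) := by
  have hO : Q =O[atTop] fun y : ℝ => y ^ (-2 : ℝ) := by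
    refine Asymptotics.isBigO_of_div_tendsto_nhds ?_ 0 ?_
    · filter_upwards [eventually_gt_atTop 0] with y hy h0
      exact absurd h0 (Real.rpow_pos_of_pos hy _).ne'
    · have h2 := h.mul (tendsto_rpow_mul_exp_neg_rpow_atTop hα (β + 2))
      rw [mul_zero] at h2
      refine h2.congr' ?_
      filter_upwards [eventually_gt_atTop 0] with y hy
      have h1 := Real.rpow_pos_of_pos hy β
      have h3 := Real.rpow_pos_of_pos hy 2
      change _ = Q y / y ^ (-2 : ℝ)
      rw [Real.rpow_add hy, Real.rpow_neg hy.le]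
      field_simp
  have hI : IntegrableAtFilter (fun y : ℝ => y ^ (-2 : ℝ)) atTop :=
    ⟨Ioi 1, Ioi_mem_atTop 1, integrableOn_Ioi_rpow_of_lt (by norm_num) one_pos⟩
  exact ((hQ.locallyIntegrable.locallyIntegrableOn (Ici a)).integrableOn_of_isBigO_atTop hO
    hI).mono_set Ioi_subset_Ici_self

theorem hasDerivAt_integral_Ioi {Q : ℝ → ℝ} (hQ : Continuous Q)
    (hI : ∀ a, IntegrableOn Q (Ioi a)) (y : ℝ) :
    HasDerivAt (fun y => ∫ x in Ioi y, Q x) (-Q y) y := by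
  have h : (fun y => ∫ x in Ioi y, Q x) = fun y => (∫ x in Ioi 0, Q x) - ∫ x in (0 : ℝ)..y, Q x := by
    funext z
    rw [← intervalIntegral.integral_Ioi_sub_Ioi' (hI 0) (hI z)]
    ring
  rw [h]
  exact (hQ.integral_hasStrictDerivAt 0 y).hasDerivAt.const_sub _

theorem tendsto_integral_Ioi_div {α β c : ℝ} (hα : 0 < α) {Q : ℝ → ℝ}
    (hQ : Continuous Q)
    (h : Tendsto (fun y => Q y / (y ^ β * Real.exp (-(y ^ α)))) atTop (𝓝 c)) :
    Tendsto (fun y => (∫ x in Ioi y, Q x) / (y ^ (β + 1 - α) * Real.exp (-(y ^ α)))) atTop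
      (𝓝 (c / α)) := by
  have hI := integrableOn_Ioi_of_tendsto_div hα hQ h
  have hden : Tendsto (fun y : ℝ => α - (β + 1 - α) * y ^ (-α)) atTop (𝓝 α) := by
    simpa using ((tendsto_rpow_neg_atTop hα).const_mul (β + 1 - α)).const_sub α
  have hfac : ∀ y : ℝ, 0 < y →
      (β + 1 - α) * y ^ (β + 1 - α - 1) * Real.exp (-(y ^ α)) +
        y ^ (β + 1 - α) * (Real.exp (-(y ^ α)) * -(α * y ^ (α - 1))) =
      -((y ^ β * Real.exp (-(y ^ α))) * (α - (β + 1 - α) * y ^ (-α))) := by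
    intro y hy
    have h1 : y ^ (β + 1 - α - 1) = y ^ β * y ^ (-α) := by
      rw [← Real.rpow_add hy]; congr 1; ring
    have h2 : y ^ (β + 1 - α) * y ^ (α - 1) = y ^ β := by
      rw [← Real.rpow_add hy]; congr 1; ring
    rw [h1, ← h2]
    ring
  refine HasDerivAt.lhopital_zero_atTop
    (Eventually.of_forall (hasDerivAt_integral_Ioi hQ hI))
    (g' := fun y => (β + 1 - α) * y ^ (β + 1 - α - 1) * Real.exp (-(y ^ α)) +
        y ^ (β + 1 - α) * (Real.exp (-(y ^ α)) * -(α * y ^ (α - 1)))) ?_ ?_ ?_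
    (tendsto_rpow_mul_exp_neg_rpow_atTop hα _) ?_
  · filter_upwards [eventually_gt_atTop 0] with y hy
    exact (Real.hasDerivAt_rpow_const (Or.inl hy.ne')).mul
      (Real.hasDerivAt_rpow_const (Or.inl hy.ne')).neg.exp
  · filter_upwards [eventually_gt_atTop 0, hden.eventually_ne hα.ne'] with y hy hy2
    rw [hfac y hy]
    have := Real.rpow_pos_of_pos hy β
    have := Real.exp_pos (-(y ^ α))
    exact neg_ne_zero.2 (mul_ne_zero (by positivity) hy2)
  · exact tendsto_integral_Ioi_zero tendsto_id
  · refine (h.div hden hα.ne').congr' ?_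
    filter_upwards [eventually_gt_atTop 0] with y hy
    rw [Pi.div_apply, hfac y hy, neg_div_neg_eq, div_div]

theorem C0_pos {α : ℝ} (hα : 0 < α) : 0 < C0 α := by
  unfold C0
  rw [integral_comp_abs (f := fun x => Real.exp (-(x ^ α))), integral_exp_neg_rpow hα]
  have := Real.Gamma_pos_of_pos (show 0 < 1 / α + 1 by positivity)
  positivity

theorem continuous_fd {α : ℝ} (hα : 0 < α) (θ : ℝ) : Continuous (fd α θ) := by
  unfold fd
  have : Continuous fun x : ℝ => |x - θ| ^ α :=
    (by fun_prop : Continuous fun x : ℝ => |x - θ|).rpow_const fun _ => Or.inr hα.le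
  fun_prop

theorem tendsto_fd_div (α : ℝ) :
    Tendsto (fun y => fd α 0 y / (y ^ (0 : ℝ) * Real.exp (-(y ^ α)))) atTop (𝓝 (C0 α)) := by
  refine tendsto_const_nhds.congr' ?_
  filter_upwards [eventually_gt_atTop 0] with y hy
  rw [fd, sub_zero, abs_of_pos hy, Real.rpow_zero, one_mul,
    mul_div_cancel_right₀ _ (Real.exp_pos _).ne']

theorem continuous_Ptail {α : ℝ} (hα : 0 < α) : Continuous (Ptail α 0) :=
  continuous_iff_continuousAt.2 fun y => (hasDerivAt_integral_Ioi (continuous_fd hα 0)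
    (integrableOn_Ioi_of_tendsto_div hα (continuous_fd hα 0) (tendsto_fd_div α)) y).continuousAt

theorem tendsto_Ptail_div {α : ℝ} (hα : 0 < α) :
    Tendsto (fun y => Ptail α 0 y / (y ^ (0 + 1 - α) * Real.exp (-(y ^ α)))) atTop
      (𝓝 (C0 α / α)) :=
  tendsto_integral_Ioi_div hα (continuous_fd hα 0) (tendsto_fd_div α)

theorem tendsto_integral_Ptail_div {α : ℝ} (hα : 0 < α) :
    Tendsto (fun y => (∫ x in Ioi y, Ptail α 0 x) /
      (y ^ (0 + 1 - α + 1 - α) * Real.exp (-(y ^ α)))) atTop (𝓝 (C0 α / α / α)) :=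
  tendsto_integral_Ioi_div hα (continuous_Ptail hα) (tendsto_Ptail_div hα)

theorem integral_Ioi_comp_sub_right (Q : ℝ → ℝ) (S θ : ℝ) :
    ∫ x in Ioi S, Q (x - θ) = ∫ x in Ioi (S - θ), Q x := by
  have h := (measurePreserving_sub_right volume θ).setIntegral_preimage_emb
    (Homeomorph.subRight θ).measurableEmbedding Q (Ioi (S - θ))
  simpa using h

theorem Ptail_eq_sub (α θ S : ℝ) : Ptail α θ S = Ptail α 0 (S - θ) := by
  unfold Ptail
  rw [← integral_Ioi_comp_sub_right]
  simp [fd]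

theorem integral_Ptail_eq_sub (α θ S : ℝ) :
    ∫ x in Ioi S, Ptail α θ x = ∫ x in Ioi (S - θ), Ptail α 0 x := by
  rw [← integral_Ioi_comp_sub_right]
  simp [← Ptail_eq_sub]

theorem antitone_integral_Ptail {α : ℝ} (hα : 0 < α) :
    Antitone fun y => ∫ x in Ioi y, Ptail α 0 x := by
  intro a b hab
  refine setIntegral_mono_set (integrableOn_Ioi_of_tendsto_div hα (continuous_Ptail hα)
    (tendsto_Ptail_div hα) a) (Eventually.of_forall fun x => ?_)
    (Ioi_subset_Ioi hab).eventuallyLE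
  exact integral_nonneg fun z => mul_nonneg (C0_pos hα).le (Real.exp_pos _).le

theorem eventually_integral_Ptail_pos {α : ℝ} (hα : 0 < α) :
    ∀ᶠ y in atTop, 0 < ∫ x in Ioi y, Ptail α 0 x := by
  have hc : 0 < C0 α / α / α := by have := C0_pos hα; positivity
  filter_upwards [(tendsto_integral_Ptail_div hα).eventually_const_lt hc, eventually_gt_atTop 0]
    with y hy hy0
  have : 0 < y ^ (0 + 1 - α + 1 - α) := Real.rpow_pos_of_pos hy0 _
  exact (div_pos_iff_of_pos_right (by positivity)).1 hy

theorem tendsto_gfun_div {α : ℝ} (hα : 0 < α) :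
    Tendsto (fun y => gfun α 0 y / (α * y ^ (α - 1))) atTop (𝓝 1) := by
  have hC := C0_pos hα
  have h := ((tendsto_Ptail_div hα).div (tendsto_integral_Ptail_div hα)
    (by positivity)).div_const α
  have h1 : C0 α / α / (C0 α / α / α) / α = 1 := by field_simp
  rw [h1] at h
  refine h.congr' ?_
  filter_upwards [eventually_gt_atTop 0, eventually_integral_Ptail_pos hα] with y hy hG
  have h2 : y ^ (0 + 1 - α) = y ^ (0 + 1 - α + 1 - α) * y ^ (α - 1) := by
    rw [← Real.rpow_add hy]; congr 1; ring
  have h3 := Real.rpow_pos_of_pos hy (0 + 1 - α + 1 - α)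
  have h4 := Real.rpow_pos_of_pos hy (α - 1)
  rw [Pi.div_apply, h2, gfun]
  field_simp

theorem tendsto_neg_log_integral_Ptail_div {α : ℝ} (hα : 0 < α) :
    Tendsto (fun y => -Real.log (∫ x in Ioi y, Ptail α 0 x) / y ^ α) atTop (𝓝 1) := by
  have hc : 0 < C0 α / α / α := by have := C0_pos hα; positivity
  have h := tendsto_integral_Ptail_div hα
  have h1 := (h.log hc.ne').div_atTop (tendsto_rpow_atTop hα)
  have h2 := ((isLittleO_log_rpow_atTop hα).tendsto_div_nhds_zero).const_mul
    (0 + 1 - α + 1 - α)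
  have h3 := (h1.add h2).const_sub 1
  simp only [mul_zero, add_zero, sub_zero] at h3
  refine h3.congr' ?_
  filter_upwards [eventually_gt_atTop 0, eventually_integral_Ptail_pos hα] with y hy hG
  have h4 := Real.rpow_pos_of_pos hy (0 + 1 - α + 1 - α)
  have h5 := Real.rpow_pos_of_pos hy α
  rw [Real.log_div hG.ne' (by positivity), Real.log_mul h4.ne' (Real.exp_pos _).ne',
    Real.log_exp, Real.log_rpow hy]
  field_simp
  ring

theorem gfun_eq_sub (α θ S : ℝ) : gfun α θ S = gfun α 0 (S - θ) := by
  rw [gfun, gfun, integral_Ptail_eq_sub, Ptail_eq_sub]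

theorem tendsto_log_one_div_one_sub :
    Tendsto (fun γ : ℝ => Real.log (1 / (1 - γ))) (𝓝[<] (1 : ℝ)) atTop := by
  refine Real.tendsto_log_atTop.comp ?_
  simp only [one_div]
  refine tendsto_inv_nhdsGT_zero.comp (tendsto_nhdsWithin_iff.2 ⟨?_, ?_⟩)
  · exact tendsto_nhdsWithin_of_tendsto_nhds
      ((by fun_prop : Continuous fun γ : ℝ => 1 - γ).tendsto' 1 0 (sub_self 1))
  · filter_upwards [self_mem_nhdsWithin] with γ hγ
    exact sub_pos.2 (mem_Iio.1 hγ)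

theorem tendsto_root_div {ι : Type*} {l : Filter ι} {α : ℝ} (hα : 0 < α) {γ θ s : ι → ℝ}
    (hγ : Tendsto γ l (𝓝[<] 1))
    (hθ : Tendsto (fun i => θ i / Real.log (1 / (1 - γ i)) ^ (1 / α)) l (𝓝 0))
    (hs : ∀ᶠ i in l, (1 - γ i) / γ i * s i = ∫ x in Ioi (s i - θ i), Ptail α 0 x) :
    Tendsto (fun i => s i / Real.log (1 / (1 - γ i)) ^ (1 / α)) l (𝓝 1) := by
  set L : ι → ℝ := fun i => Real.log (1 / (1 - γ i)) with hL
  have hLtop : Tendsto L l atTop := tendsto_log_one_div_one_sub.comp hγ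
  have hMtop : Tendsto (fun i => L i ^ (1 / α)) l atTop :=
    (tendsto_rpow_atTop (by positivity)).comp hLtop
  have hγ1 : ∀ᶠ i in l, γ i < 1 := hγ.eventually self_mem_nhdsWithin
  have hγ' : Tendsto γ l (𝓝 1) := hγ.mono_right nhdsWithin_le_nhds
  have hγ0 : ∀ᶠ i in l, 0 < γ i := hγ'.eventually_const_lt one_pos
  have hquot : ∀ a : ℝ, Tendsto (fun i => (a * L i ^ (1 / α) - θ i) / L i ^ (1 / α)) l (𝓝 a) := by
    intro a
    have h := hθ.const_sub a
    rw [sub_zero] at h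
    refine h.congr' ?_
    filter_upwards [hMtop.eventually_gt_atTop 0] with i hi
    rw [sub_div, mul_div_cancel_right₀ _ hi.ne']
  have harg : ∀ a : ℝ, 0 < a → Tendsto (fun i => a * L i ^ (1 / α) - θ i) l atTop := by
    intro a ha
    refine (hMtop.atTop_mul_pos ha (hquot a)).congr' ?_
    filter_upwards [hMtop.eventually_gt_atTop 0] with i hi
    rw [mul_div_cancel₀ _ hi.ne']
  have htail : ∀ a : ℝ, 0 < a →
      Tendsto (fun i => -Real.log (∫ x in Ioi (a * L i ^ (1 / α) - θ i), Ptail α 0 x) / L i) l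
        (𝓝 (a ^ α)) := by
    intro a ha
    have h := ((tendsto_neg_log_integral_Ptail_div hα).comp (harg a ha)).mul
      ((hquot a).rpow_const (Or.inr hα.le))
    rw [one_mul] at h
    refine h.congr' ?_
    filter_upwards [hLtop.eventually_gt_atTop 0, (harg a ha).eventually_gt_atTop 0] with i hi hi2
    have h1 : (L i ^ (1 / α)) ^ α = L i := by
      rw [← Real.rpow_mul hi.le, one_div_mul_cancel hα.ne', Real.rpow_one]
    have h2 := Real.rpow_pos_of_pos hi2 α
    rw [Real.div_rpow hi2.le (Real.rpow_nonneg hi.le _), h1, Function.comp_apply]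
    field_simp
  have hlin : ∀ a : ℝ, 0 < a →
      Tendsto (fun i => -Real.log ((1 - γ i) / γ i * (a * L i ^ (1 / α))) / L i) l (𝓝 1) := by
    intro a ha
    have h1 : Tendsto (fun i => (Real.log (γ i) - Real.log a) / L i) l (𝓝 0) :=
      ((hγ'.log one_ne_zero).sub_const (Real.log a)).div_atTop hLtop
    have h2 : Tendsto (fun i => 1 / α * (Real.log (L i) / L i)) l (𝓝 (1 / α * 0)) :=
      ((Real.isLittleO_log_id_atTop.tendsto_div_nhds_zero).comp hLtop).const_mul (1 / α)
    have h3 := (h1.sub h2).const_add 1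
    simp only [mul_zero, sub_zero, add_zero] at h3
    refine h3.congr' ?_
    filter_upwards [hLtop.eventually_gt_atTop 0, hγ0, hγ1] with i hi h0 h1
    have hM := Real.rpow_pos_of_pos hi (1 / α)
    have h4 : 0 < 1 - γ i := sub_pos.2 h1
    have h5 : L i = -Real.log (1 - γ i) := by rw [hL]; simp
    have h6 : Real.log ((1 - γ i) / γ i * (a * L i ^ (1 / α))) =
        -L i - Real.log (γ i) + (Real.log a + 1 / α * Real.log (L i)) := by
      rw [Real.log_mul (by positivity) (by positivity), Real.log_div h4.ne' h0.ne',
        Real.log_mul ha.ne' hM.ne', Real.log_rpow hi, h5, neg_neg]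
    rw [h6]
    field_simp
    ring
  refine tendsto_order.2 ⟨fun b hb => ?_, fun b hb => ?_⟩
  · set a := max b (1 / 2) with ha
    have ha0 : 0 < a := lt_max_of_lt_right (by norm_num)
    have ha1 : a < 1 := max_lt hb (by norm_num)
    filter_upwards [hs, hγ0, hγ1, hLtop.eventually_gt_atTop 0,
      (htail a ha0).eventually_lt (hlin a ha0) (Real.rpow_lt_one ha0.le ha1 hα),
      (harg a ha0).eventually (eventually_integral_Ptail_pos hα)] with i hsi h0 h1 hi hlt hG
    have hM := Real.rpow_pos_of_pos hi (1 / α)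
    have h4 : 0 < (1 - γ i) / γ i := div_pos (sub_pos.2 h1) h0
    rw [div_lt_div_iff_of_pos_right hi, neg_lt_neg_iff,
      Real.log_lt_log_iff (by positivity) hG] at hlt
    by_contra! hle
    have hle' : s i ≤ a * L i ^ (1 / α) := (div_le_iff₀ hM).1 (hle.trans (le_max_left _ _))
    have h5 := antitone_integral_Ptail hα (sub_le_sub_right hle' (θ i))
    have h6 := mul_le_mul_of_nonneg_left hle' h4.le
    simp only at h5
    linarith
  · have hb0 : 0 < b := one_pos.trans hb
    filter_upwards [hs, hγ0, hγ1, hLtop.eventually_gt_atTop 0,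
      (hlin b hb0).eventually_lt (htail b hb0) (Real.one_lt_rpow hb hα),
      (harg b hb0).eventually (eventually_integral_Ptail_pos hα)] with i hsi h0 h1 hi hlt hG
    have hM := Real.rpow_pos_of_pos hi (1 / α)
    have h4 : 0 < (1 - γ i) / γ i := div_pos (sub_pos.2 h1) h0
    rw [div_lt_div_iff_of_pos_right hi, neg_lt_neg_iff,
      Real.log_lt_log_iff hG (by positivity)] at hlt
    by_contra! hle
    have hle' : b * L i ^ (1 / α) ≤ s i := (le_div_iff₀ hM).1 hle
    have h5 := antitone_integral_Ptail hα (sub_le_sub_right hle' (θ i))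
    have h6 := mul_le_mul_of_nonneg_left hle' h4.le
    simp only at h5
    linarith

theorem tendsto_gfun_root_div {ι : Type*} {l : Filter ι} {α : ℝ} (hα : 0 < α) {L θ s : ι → ℝ}
    (hL : Tendsto L l atTop) (hθ : Tendsto (fun i => θ i / L i ^ (1 / α)) l (𝓝 0))
    (hs : Tendsto (fun i => s i / L i ^ (1 / α)) l (𝓝 1)) :
    Tendsto (fun i => gfun α (θ i) (s i) / (α * L i ^ (1 - 1 / α))) l (𝓝 1) := by
  have hMtop : Tendsto (fun i => L i ^ (1 / α)) l atTop :=
    (tendsto_rpow_atTop (by positivity)).comp hL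
  have hquot : Tendsto (fun i => (s i - θ i) / L i ^ (1 / α)) l (𝓝 1) := by
    simpa [sub_div] using hs.sub hθ
  have harg : Tendsto (fun i => s i - θ i) l atTop := by
    refine (hMtop.atTop_mul_pos one_pos hquot).congr' ?_
    filter_upwards [hMtop.eventually_gt_atTop 0] with i hi
    rw [mul_div_cancel₀ _ hi.ne']
  have h := ((tendsto_gfun_div hα).comp harg).mul
    (hquot.rpow_const (p := α - 1) (Or.inl one_ne_zero))
  rw [Real.one_rpow, one_mul] at h
  refine h.congr' ?_
  filter_upwards [hL.eventually_gt_atTop 0, harg.eventually_gt_atTop 0] with i hi hi2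
  have h1 : (L i ^ (1 / α)) ^ (α - 1) = L i ^ (1 - 1 / α) := by
    rw [← Real.rpow_mul hi.le]
    congr 1
    field_simp
  have h2 := Real.rpow_pos_of_pos hi2 (α - 1)
  have h3 := Real.rpow_pos_of_pos hi (1 - 1 / α)
  rw [Real.div_rpow hi2.le (Real.rpow_nonneg hi.le _), h1, Function.comp_apply,
    gfun_eq_sub α (θ i)]
  field_simp

/-- Uniform approximation of `g_θ(S*(θ,γ))` and `S*(θ,γ)·g_θ(S*(θ,γ))`
for `θ ∈ [θ₀−f(γ), θ₀+f(γ)]` as `γ → 1⁻`. -/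
theorem stmt_8 (α : ℝ) (hα : 1/2 ≤ α)
    (Sstar : ℝ → ℝ → ℝ)
    (hS : ∀ θ : ℝ, ∀ γ ∈ Set.Ioo (0:ℝ) 1,
      0 < Sstar θ γ ∧
      ((1-γ)/γ) * Sstar θ γ = (∫ x in Set.Ioi (Sstar θ γ), Ptail α θ x) ∧
      ∀ S, 0 < S → ((1-γ)/γ) * S = (∫ x in Set.Ioi S, Ptail α θ x) → S = Sstar θ γ)
    (f : ℝ → ℝ) (hf0 : ∀ γ, 0 ≤ f γ)
    (hf : Tendsto (fun γ => f γ / (Real.log (1/(1-γ))) ^ (1/α)) (𝓝[<] (1:ℝ)) (𝓝 0))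
    (θ₀ : ℝ) :
    (∀ c > 0, ∀ᶠ γ in 𝓝[<] (1:ℝ), ∀ θ ∈ Set.Icc (θ₀ - f γ) (θ₀ + f γ),
      |gfun α θ (Sstar θ γ) / (α * (Real.log (1/(1-γ))) ^ (1 - 1/α)) - 1| ≤ c) ∧
    (∀ c > 0, ∀ᶠ γ in 𝓝[<] (1:ℝ), ∀ θ ∈ Set.Icc (θ₀ - f γ) (θ₀ + f γ),
      |Sstar θ γ * gfun α θ (Sstar θ γ) / (α * Real.log (1/(1-γ))) - 1| ≤ c) := by
  have hα0 : 0 < α := by linarith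
  set l : Filter (ℝ × ℝ) := comap Prod.fst (𝓝[<] (1 : ℝ)) ⊓
    𝓟 {p | p.2 ∈ Set.Icc (θ₀ - f p.1) (θ₀ + f p.1)} with hl
  have hiff : ∀ {p : ℝ × ℝ → Prop}, (∀ᶠ x in l, p x) →
      ∀ᶠ γ in 𝓝[<] (1 : ℝ), ∀ θ ∈ Set.Icc (θ₀ - f γ) (θ₀ + f γ), p (γ, θ) := by
    intro p hp
    rw [hl, eventually_inf_principal, eventually_comap] at hp
    filter_upwards [hp] with γ hγ θ hθ
    exact hγ (γ, θ) rfl hθ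
  have hγ : Tendsto Prod.fst l (𝓝[<] (1 : ℝ)) := tendsto_comap.mono_left inf_le_left
  have hmem : ∀ᶠ x in l, x.2 ∈ Set.Icc (θ₀ - f x.1) (θ₀ + f x.1) :=
    mem_inf_of_right (mem_principal_self _)
  have hLtop : Tendsto (fun x : ℝ × ℝ => Real.log (1 / (1 - x.1))) l atTop :=
    tendsto_log_one_div_one_sub.comp hγ
  have hMtop : Tendsto (fun x : ℝ × ℝ => Real.log (1 / (1 - x.1)) ^ (1 / α)) l atTop :=
    (tendsto_rpow_atTop (by positivity)).comp hLtop
  have hθ : Tendsto (fun x : ℝ × ℝ => x.2 / Real.log (1 / (1 - x.1)) ^ (1 / α)) l (𝓝 0) := by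
    have hbound := (hMtop.const_div_atTop |θ₀|).add (hf.comp hγ)
    rw [add_zero] at hbound
    refine squeeze_zero_norm' ?_ hbound
    filter_upwards [hmem, hMtop.eventually_gt_atTop 0] with x hx hM
    rw [Function.comp_apply, ← add_div, norm_div, Real.norm_eq_abs, Real.norm_of_nonneg hM.le]
    gcongr
    have := neg_abs_le θ₀
    have := le_abs_self θ₀
    exact abs_le.2 ⟨by linarith [hx.1], by linarith [hx.2]⟩
  have hroot : Tendsto
      (fun x : ℝ × ℝ => Sstar x.2 x.1 / Real.log (1 / (1 - x.1)) ^ (1 / α)) l (𝓝 1) := by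
    refine tendsto_root_div hα0 hγ hθ ?_
    filter_upwards [hγ.eventually self_mem_nhdsWithin,
      (hγ.mono_right nhdsWithin_le_nhds).eventually_const_lt one_pos] with x h1 h0
    rw [(hS x.2 x.1 ⟨h0, h1⟩).2.1, integral_Ptail_eq_sub]
  have hg := tendsto_gfun_root_div hα0 hLtop hθ hroot
  have hSg : Tendsto (fun x : ℝ × ℝ => Sstar x.2 x.1 * gfun α x.2 (Sstar x.2 x.1) /
      (α * Real.log (1 / (1 - x.1)))) l (𝓝 1) := by
    have h := hroot.mul hg
    rw [one_mul] at h
    refine h.congr' ?_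
    filter_upwards [hLtop.eventually_gt_atTop 0] with x hx
    rw [div_mul_div_comm]
    congr 1
    rw [mul_left_comm, ← Real.rpow_add hx, add_sub_cancel, Real.rpow_one]
  have hclose : ∀ {u : ℝ × ℝ → ℝ}, Tendsto u l (𝓝 1) → ∀ c > 0, ∀ᶠ x in l, |u x - 1| ≤ c := by
    intro u hu c hc
    filter_upwards [Metric.tendsto_nhds.1 hu c hc] with x hx
    exact (Real.dist_eq (u x) 1 ▸ hx).le
  exact ⟨fun c hc => hiff (hclose hg c hc), fun c hc => hiff (hclose hSg c hc)⟩
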